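/- arXiv:1212.3722 — 6 statements merged into one kernel-verified Lean document; each statement's English description precedes it below -/
import Mathlib

section
/- Let K be a field, E a finite-dimensional K-vector space, u an endomorphism of E, F a u-stable subspace of E, and α ∈ K an eigenvalue of the restriction u|_F of u to F. Then the characteristic projection π_{E,α}(u) of u at α maps F into F, and its restriction to F equals the characteristic projection π_{F,α}(u|_F) of u|_F at α. -/
open Polynomial

/-- Evaluating a polynomial at the restriction of `u` to a stable subspace restricts the
evaluation at `u`. -/
theorem coe_aeval_restrict_apply {R M : Type*} [CommRing R] [AddCommGroup M] [Module R M]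
    (u : Module.End R M) (N : Submodule R M) (hN : ∀ x ∈ N, u x ∈ N) (p : R[X]) (x : N) :
    ((aeval (u.restrict hN) p) x : M) = aeval u p (x : M) := by
  induction p using Polynomial.induction_on' with
  | add p q hp hq => simp [hp, hq]
  | monomial n a => simp [aeval_monomial, Module.End.pow_restrict n hN]

/-- The minimal polynomial of a restriction divides the minimal polynomial. -/
theorem minpoly_restrict_dvd {K E : Type*} [Field K] [AddCommGroup E] [Module K E]
    (u : Module.End K E) (F : Submodule K E) (hF : ∀ x ∈ F, u x ∈ F) :
    minpoly K (u.restrict hF) ∣ minpoly K u := by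
  refine minpoly.dvd K _ ?_
  ext x
  simp [coe_aeval_restrict_apply]

/-- The Bézout idempotents of two coprime factorizations `L ^ n * Q` and `L ^ m * Q'`, the second
dividing the first, agree modulo the second. -/
theorem mul_dvd_sub_of_bezout {R : Type*} [CommRing R] {L Q A B Q' A' B' : R} {n m : ℕ}
    (hn : 1 ≤ n) (hm : 1 ≤ m) (h : L ^ n * A + Q * B = 1) (h' : L ^ m * A' + Q' * B' = 1)
    (hdvd : L ^ m * Q' ∣ L ^ n * Q) : L ^ m * Q' ∣ Q * B - Q' * B' := by
  have hcop : IsCoprime (L ^ n) Q := ⟨A, B, by linear_combination h⟩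
  have hcop' : IsCoprime (L ^ m) Q' := ⟨A', B', by linear_combination h'⟩
  have hL : L ^ m ∣ L ^ n :=
    (((IsCoprime.pow_left_iff hn).1 hcop).pow_left).dvd_of_dvd_mul_right
      ((dvd_mul_right _ _).trans hdvd)
  have hQ : Q' ∣ Q :=
    (((IsCoprime.pow_left_iff hm).1 hcop').pow_left.symm).dvd_of_dvd_mul_left
      ((dvd_mul_left _ _).trans hdvd)
  refine hcop'.mul_dvd ?_ (dvd_sub (hQ.mul_right B) (dvd_mul_right _ _))
  have hsub : Q * B - Q' * B' = L ^ m * A' - L ^ n * A := by linear_combination h - h'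
  exact hsub ▸ dvd_sub (dvd_mul_right _ _) (hL.mul_right A)

/-- Stability by restriction: if `F` is a `u`-stable subspace and `α` is an eigenvalue of
`u|_F`, then the characteristic projection `π_{E,α}(u) = Q(u) ∘ B(u)` (computed from the
minimal polynomial of `u` and a Bézout pair) maps `F` into `F`, and its restriction to `F`
is the characteristic projection `π_{F,α}(u|_F) = Q'(u|_F) ∘ B'(u|_F)` (computed from the
minimal polynomial of `u|_F` and a Bézout pair). -/
theorem characteristic_projection_restricts
    {K : Type*} [Field K] {E : Type*} [AddCommGroup E] [Module K E]
    [FiniteDimensional K E] (u : Module.End K E) (F : Submodule K E)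
    (hF : ∀ x ∈ F, u x ∈ F) (α : K)
    (hα : Module.End.HasEigenvalue (u.restrict hF) α)
    (ν : ℕ) (hν : 1 ≤ ν) (Q A B : K[X]) (hQ : Q.eval α ≠ 0)
    (hmin : minpoly K u = (X - C α) ^ ν * Q)
    (hbez : (X - C α) ^ ν * A + Q * B = 1)
    (ν' : ℕ) (hν' : 1 ≤ ν') (Q' A' B' : K[X]) (hQ' : Q'.eval α ≠ 0)
    (hmin' : minpoly K (u.restrict hF) = (X - C α) ^ ν' * Q')
    (hbez' : (X - C α) ^ ν' * A' + Q' * B' = 1) :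
    (∀ x ∈ F, (aeval u (Q * B)) x ∈ F) ∧
    ∀ x : F, (aeval u (Q * B)) (x : E) = ((aeval (u.restrict hF) (Q' * B')) x : E) := by
  have hdvd : minpoly K (u.restrict hF) ∣ Q * B - Q' * B' := by
    rw [hmin']
    exact mul_dvd_sub_of_bezout hν hν' hbez hbez' (hmin' ▸ hmin ▸ minpoly_restrict_dvd u F hF)
  have heq : aeval (u.restrict hF) (Q * B) = aeval (u.restrict hF) (Q' * B') := by
    rw [← sub_eq_zero, ← map_sub]
    exact (minpoly.dvd_iff).1 hdvd
  refine ⟨fun x hx => ?_, fun x => ?_⟩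
  · rw [← coe_aeval_restrict_apply u F hF (Q * B) ⟨x, hx⟩]
    exact Subtype.property _
  · rw [← heq, coe_aeval_restrict_apply]
end

section
/- Let K be a field, E a finite-dimensional K-vector space, u an endomorphism of E, and α ∈ K an eigenvalue of u. Let P ∈ K[X] be ANY annihilating polynomial of u (P(u) = 0), factored as P = (X − α)^m · R with m ≥ 1 and R(α) ≠ 0, and let (C, D) be polynomials with (X − α)^m · C + R · D = 1. Then R(u) ∘ D(u) equals the characteristic projection π_{E,α}(u) computed from the minimal polynomial of u; in other words, the characteristic projection does not depend on the choice of annihilating polynomial. -/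
open Polynomial

theorem isCoprime_X_sub_C_of_eval_ne_zero {K : Type*} [Field K] {p : K[X]} {a : K}
    (h : p.eval a ≠ 0) : IsCoprime (X - C a) p :=
  (irreducible_X_sub_C a).coprime_iff_not_dvd.2 fun hd => h (dvd_iff_isRoot.1 hd)

/-- Independence from the annihilating polynomial: if `P = (X - α)^m * R` annihilates `u`,
with `m ≥ 1`, `R(α) ≠ 0` and `(X - α)^m * C + R * D = 1`, then `R(u) ∘ D(u)` equals the
characteristic projection computed from the minimal polynomial `(X - α)^ν * Q` of `u` and
a Bézout pair `(A, B)`. -/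
theorem characteristic_projection_indep_of_annihilator
    {K : Type*} [Field K] {E : Type*} [AddCommGroup E] [Module K E]
    [FiniteDimensional K E] (u : Module.End K E) (α : K)
    (hα : Module.End.HasEigenvalue u α)
    (ν : ℕ) (hν : 1 ≤ ν) (Q A B : K[X]) (hQ : Q.eval α ≠ 0)
    (hmin : minpoly K u = (X - C α) ^ ν * Q)
    (hbez : (X - C α) ^ ν * A + Q * B = 1)
    (P : K[X]) (hann : aeval u P = 0)
    (m : ℕ) (hm : 1 ≤ m) (R C' D : K[X]) (hR : R.eval α ≠ 0)
    (hP : P = (X - C α) ^ m * R)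
    (hbez' : (X - C α) ^ m * C' + R * D = 1) :
    aeval u R * aeval u D = aeval u Q * aeval u B := by
  have hdvd : (X - C α) ^ ν * Q ∣ (X - C α) ^ m * R := by
    rw [← hmin, ← hP]
    exact minpoly.dvd K u hann
  have hpow : (X - C α) ^ ν ∣ (X - C α) ^ m :=
    (isCoprime_X_sub_C_of_eval_ne_zero hR).pow_left.dvd_of_dvd_mul_right
      ((dvd_mul_right _ _).trans hdvd)
  have hQR : Q ∣ R :=
    (isCoprime_X_sub_C_of_eval_ne_zero hQ).symm.pow_right.dvd_of_dvd_mul_left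
      ((dvd_mul_left _ _).trans hdvd)
  have hdiff : R * D - Q * B = (X - C α) ^ ν * A - (X - C α) ^ m * C' := by
    linear_combination hbez' - hbez
  have hmul : minpoly K u ∣ R * D - Q * B := by
    rw [hmin]
    refine (isCoprime_X_sub_C_of_eval_ne_zero hQ).pow_left.mul_dvd ?_ ?_
    · rw [hdiff]
      exact dvd_sub (dvd_mul_right _ _) (hpow.mul_right C')
    · exact dvd_sub (hQR.mul_right D) (dvd_mul_right Q B)
  rw [← map_mul, ← map_mul, ← sub_eq_zero, ← map_sub]
  exact (minpoly.dvd_iff).1 hmul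
end

section
/- Let K be a field, E a finite-dimensional K-vector space, u an endomorphism of E, α ∈ K an eigenvalue of u, and F a u-stable subspace of E such that α is NOT an eigenvalue of the restriction u|_F. Then the characteristic projection π_{E,α}(u) vanishes identically on F. -/
open Polynomial

/-- If `α` is not an eigenvalue of the restriction of `u` to a stable subspace `F`, then `F`
contains no nonzero vector killed by a power of `u - α`. -/
lemma eq_zero_of_aeval_X_sub_C_pow_apply_eq_zero
    {K : Type*} [Field K] {E : Type*} [AddCommGroup E] [Module K E]
    (u : Module.End K E) (α : K) (F : Submodule K E) (hF : ∀ x ∈ F, u x ∈ F)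
    (hnot : ¬ Module.End.HasEigenvalue (u.restrict hF) α) (n : ℕ) :
    ∀ y ∈ F, aeval u ((X - C α) ^ n) y = 0 → y = 0 := by
  induction n with
  | zero => simp
  | succ n ih =>
    intro y hy h
    have hz : (u - algebraMap K (Module.End K E) α) y = u y - α • y := by
      simp [Module.algebraMap_end_apply]
    have h₁ : u y - α • y = 0 := by
      refine ih _ (F.sub_mem (hF y hy) (F.smul_mem α hy)) ?_
      rw [pow_succ, map_mul, Module.End.mul_apply, map_sub, aeval_X, aeval_C, hz] at h
      exact h
    by_contra hne
    refine hnot (Module.End.hasEigenvalue_of_hasEigenvector (x := ⟨y, hy⟩)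
      (Module.End.hasEigenvector_iff.mpr ⟨?_, ?_⟩))
    · rw [Module.End.mem_eigenspace_iff]
      exact Subtype.ext (sub_eq_zero.mp h₁)
    · simpa [Subtype.ext_iff] using hne

/-- If `F` is a `u`-stable subspace and `α` is not an eigenvalue of the restriction
`u|_F`, then the characteristic projection `π_{E,α}(u) = Q(u) ∘ B(u)` vanishes
identically on `F`. -/
theorem characteristic_projection_vanishes_on_stable_subspace
    {K : Type*} [Field K] {E : Type*} [AddCommGroup E] [Module K E]
    [FiniteDimensional K E] (u : Module.End K E) (α : K)
    (hα : Module.End.HasEigenvalue u α)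
    (F : Submodule K E) (hF : ∀ x ∈ F, u x ∈ F)
    (hnot : ¬ Module.End.HasEigenvalue (u.restrict hF) α)
    (ν : ℕ) (hν : 1 ≤ ν) (Q A B : K[X]) (hQ : Q.eval α ≠ 0)
    (hmin : minpoly K u = (X - C α) ^ ν * Q)
    (hbez : (X - C α) ^ ν * A + Q * B = 1) :
    ∀ x ∈ F, (aeval u (Q * B)) x = 0 := by
  intro x hx
  refine eq_zero_of_aeval_X_sub_C_pow_apply_eq_zero u α F hF hnot ν _
    (aeval_apply_smul_mem_of_le_comap hx (Q * B) u hF) ?_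
  rw [← Module.End.mul_apply, ← map_mul, ← mul_assoc, ← hmin, map_mul, minpoly.aeval,
    zero_mul, LinearMap.zero_apply]
end

section
/- Let K be a field, E a finite-dimensional K-vector space, u an endomorphism of E, and α ∈ K an eigenvalue of u. Suppose P ∈ K[X] annihilates u (P(u) = 0) and α is a SIMPLE root of P, so P = (X − α) · Q with Q(α) ≠ 0. Then the characteristic projection of u at α equals Q(α)⁻¹ · Q(u); in particular it is a projection onto the ordinary eigenspace Ker (u − α·id) along Ker Q(u). -/
open Polynomial

/-- Simple-root case: if `P = (X - α) * Q` annihilates `u` with `Q(α) ≠ 0` (so `α` is a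
simple root of `P`), then the characteristic projection of `u` at `α` (computed from the
minimal polynomial `(X - α)^ν * Q₀` and a Bézout pair `(A₀, B₀)`) equals
`Q(α)⁻¹ • Q(u)`; in particular this operator is the projection onto the eigenspace
`Ker (u - α·id)` along `Ker Q(u)`. -/
theorem characteristic_projection_simple_root
    {K : Type*} [Field K] {E : Type*} [AddCommGroup E] [Module K E]
    [FiniteDimensional K E] (u : Module.End K E) (α : K)
    (hα : Module.End.HasEigenvalue u α)
    (P Q : K[X]) (hann : aeval u P = 0)
    (hP : P = (X - C α) * Q) (hQ : Q.eval α ≠ 0)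
    (ν : ℕ) (hν : 1 ≤ ν) (Q₀ A₀ B₀ : K[X]) (hQ₀ : Q₀.eval α ≠ 0)
    (hmin : minpoly K u = (X - C α) ^ ν * Q₀)
    (hbez : (X - C α) ^ ν * A₀ + Q₀ * B₀ = 1) :
    ((Q.eval α)⁻¹ • aeval u Q = aeval u (Q₀ * B₀)) ∧
    ((Q.eval α)⁻¹ • aeval u Q) * ((Q.eval α)⁻¹ • aeval u Q) =
      (Q.eval α)⁻¹ • aeval u Q ∧
    LinearMap.range ((Q.eval α)⁻¹ • aeval u Q) = LinearMap.ker (u - α • 1) ∧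
    LinearMap.ker ((Q.eval α)⁻¹ • aeval u Q) = LinearMap.ker (aeval u Q) := by
  set c := Q.eval α with hc
  obtain ⟨R, hR⟩ : (X - C α) ∣ Q - C c := dvd_iff_isRoot.mpr (by simp [hc])
  have hQR : Q = C c + (X - C α) * R := by rw [← hR]; ring
  have hX : aeval u (X - C α) = u - α • 1 := by
    simp [Algebra.algebraMap_eq_smul_one]
  have hNq : (u - α • 1) * aeval u Q = 0 := by rw [← hX, ← map_mul, ← hP, hann]
  have hqR : aeval u Q = c • 1 + aeval u R * (u - α • 1) := by
    conv_lhs => rw [hQR, mul_comm]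
    simp [Algebra.algebraMap_eq_smul_one]
  have hqq : aeval u Q * aeval u Q = c • aeval u Q := by
    nth_rewrite 1 [hqR]
    rw [add_mul, mul_assoc, hNq, mul_zero, add_zero, smul_mul_assoc, one_mul]
  have hcop : IsCoprime ((X - C α) ^ ν) Q := by
    refine IsCoprime.pow_left ?_
    refine (irreducible_X_sub_C α).coprime_iff_not_dvd.mpr fun h => hQ ?_
    exact dvd_iff_isRoot.mp h
  have hdvd : (X - C α) ^ ν ∣ X - C α := by
    refine hcop.dvd_of_dvd_mul_right ?_
    rw [← hP]
    exact (Dvd.intro _ hmin.symm).trans (minpoly.dvd K u hann)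
  have hNQ₀ : aeval u ((X - C α) * Q₀) = 0 := by
    rw [← minpoly.dvd_iff, hmin]
    exact mul_dvd_mul_right hdvd Q₀
  obtain ⟨k, rfl⟩ := Nat.exists_eq_add_of_le' hν
  have hpoly : Q = C c * (Q₀ * B₀) + (X - C α) * Q₀ * (R * B₀) + P * ((X - C α) ^ k * A₀) := by
    rw [hP]
    linear_combination (-Q) * hbez + Q₀ * B₀ * hQR
  have hqe : aeval u Q = c • aeval u (Q₀ * B₀) := by
    conv_lhs => rw [hpoly]
    rw [map_add, map_add, map_mul _ P, hann, map_mul _ ((X - C α) * Q₀), hNQ₀, zero_mul, zero_mul,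
      add_zero, add_zero, map_mul, aeval_C, Algebra.smul_def]
  refine ⟨?_, ?_, ?_, LinearMap.ker_smul _ _ (inv_ne_zero hQ)⟩
  · rw [hqe, inv_smul_smul₀ hQ]
  · rw [smul_mul_smul_comm, hqq, smul_smul, mul_assoc, inv_mul_cancel₀ hQ, mul_one]
  · rw [LinearMap.range_smul _ _ (inv_ne_zero hQ)]
    refine le_antisymm (LinearMap.range_le_ker_iff.mpr hNq) fun x hx => ?_
    refine ⟨c⁻¹ • x, ?_⟩
    have hqx : aeval u Q x = c • x := by
      rw [hqR, LinearMap.add_apply, Module.End.mul_apply, LinearMap.mem_ker.mp hx]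
      simp
    rw [map_smul, hqx, inv_smul_smul₀ hQ]
end

section
/- Let K be a field, E a finite-dimensional K-vector space, u an endomorphism of E, and α ∈ K an eigenvalue of u. Then the dimension of the characteristic subspace of u at α (the generalized eigenspace ⋃_{n ≥ 0} Ker (u − α·id)^n) equals the algebraic multiplicity of α, i.e. the multiplicity of the root α in the characteristic polynomial of u. -/
open Polynomial

/-- The dimension of the generalized eigenspace `⋃_{n ≥ 0} Ker (u - α·id)^n` of `u` at an
eigenvalue `α` equals the algebraic multiplicity of `α`, i.e. the multiplicity of the root
`α` in the characteristic polynomial of `u`. -/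
theorem dim_generalized_eigenspace_eq_algebraic_multiplicity
    {K : Type*} [Field K] {E : Type*} [AddCommGroup E] [Module K E]
    [FiniteDimensional K E] (u : Module.End K E) (α : K)
    (hα : Module.End.HasEigenvalue u α) :
    Module.finrank K ↥(⨆ n : ℕ, LinearMap.ker ((u - α • 1) ^ n)) =
      (LinearMap.charpoly u).rootMultiplicity α := by
  have h : ⨆ n : ℕ, LinearMap.ker ((u - α • 1) ^ n) = u.maxGenEigenspace α := by
    rw [← Module.End.iSup_genEigenspace_eq]
    exact iSup_congr fun _ ↦ Module.End.genEigenspace_nat.symm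
  rw [h, LinearMap.finrank_maxGenEigenspace_eq]
end

section
/- Let K be a field, E a finite-dimensional K-vector space, u an endomorphism of E, and α ∈ K an eigenvalue of u with multiplicity ν in the minimal polynomial, so the minimal polynomial is (X − α)^ν · Q with Q(α) ≠ 0. Then Ker Q(u) equals the range of (u − α·id)^ν, which also equals the intersection ⋂_{n ≥ 0} Im (u − α·id)^n; consequently E is the direct sum of the generalized eigenspace ⋃_{n ≥ 0} Ker (u − α·id)^n and the stable range ⋂_{n ≥ 0} Im (u − α·id)^n, and both summands are u-stable. -/
open Polynomial

theorem Polynomial.ker_aeval_le_range_aeval_of_isCoprime {R M : Type*} [CommRing R]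
    [AddCommGroup M] [Module R M] (f : Module.End R M) {p q : R[X]} (h : IsCoprime p q) :
    LinearMap.ker (aeval f q) ≤ LinearMap.range (aeval f p) := by
  obtain ⟨a, b, hab⟩ := h
  intro x hx
  rw [LinearMap.mem_ker] at hx
  refine ⟨aeval f a x, ?_⟩
  have hx' := congrArg (fun r => aeval f r x) hab
  simpa [mul_comm a p, hx] using hx'

/-- With minimal polynomial `(X - α)^ν * Q`, `Q(α) ≠ 0`: `Ker Q(u)` equals the range of
`(u - α·id)^ν`, which equals `⋂_{n ≥ 0} Im (u - α·id)^n`; consequently `E` is the direct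
sum of the generalized eigenspace `⋃_{n ≥ 0} Ker (u - α·id)^n` and the stable range
`⋂_{n ≥ 0} Im (u - α·id)^n`, and both summands are `u`-stable. -/
theorem fitting_decomposition
    {K : Type*} [Field K] {E : Type*} [AddCommGroup E] [Module K E]
    [FiniteDimensional K E] (u : Module.End K E) (α : K)
    (hα : Module.End.HasEigenvalue u α)
    (ν : ℕ) (hν : 1 ≤ ν) (Q : K[X]) (hQ : Q.eval α ≠ 0)
    (hmin : minpoly K u = (X - C α) ^ ν * Q) :
    LinearMap.ker (aeval u Q) = LinearMap.range ((u - α • 1) ^ ν) ∧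
    LinearMap.range ((u - α • 1) ^ ν) = ⨅ n : ℕ, LinearMap.range ((u - α • 1) ^ n) ∧
    IsCompl (⨆ n : ℕ, LinearMap.ker ((u - α • 1) ^ n))
      (⨅ n : ℕ, LinearMap.range ((u - α • 1) ^ n)) ∧
    (∀ x ∈ ⨆ n : ℕ, LinearMap.ker ((u - α • 1) ^ n),
      u x ∈ ⨆ n : ℕ, LinearMap.ker ((u - α • 1) ^ n)) ∧
    (∀ x ∈ ⨅ n : ℕ, LinearMap.range ((u - α • 1) ^ n),
      u x ∈ ⨅ n : ℕ, LinearMap.range ((u - α • 1) ^ n)) := by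
  have haeval (n : ℕ) : aeval u ((X - C α) ^ n) = (u - α • 1) ^ n := by
    simp [Algebra.algebraMap_eq_smul_one]
  have hcomm (n : ℕ) : Commute ((u - α • 1) ^ n) u :=
    ((Commute.refl u).sub_left ((Commute.one_left u).smul_left α)).pow_left n
  have hle : LinearMap.range ((u - α • 1) ^ ν) ≤ LinearMap.ker (aeval u Q) := by
    rintro _ ⟨y, rfl⟩
    rw [LinearMap.mem_ker, ← haeval, ← Module.End.mul_apply, ← map_mul, mul_comm, ← hmin,
      minpoly.aeval, LinearMap.zero_apply]
  have hcop : IsCoprime (X - C α) Q :=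
    (irreducible_X_sub_C α).coprime_iff_not_dvd.mpr fun h => hQ (dvd_iff_isRoot.mp h)
  have hker (n : ℕ) : LinearMap.ker (aeval u Q) ≤ LinearMap.range ((u - α • 1) ^ n) := by
    rw [← haeval]
    exact ker_aeval_le_range_aeval_of_isCoprime u hcop.pow_left
  refine ⟨le_antisymm (hker ν) hle, le_antisymm (le_iInf fun n => hle.trans (hker n))
    (iInf_le _ ν), LinearMap.isCompl_iSup_ker_pow_iInf_range_pow _, ?_, ?_⟩
  · change (⨆ n : ℕ, LinearMap.ker ((u - α • 1) ^ n)) ≤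
      Submodule.comap u (⨆ n : ℕ, LinearMap.ker ((u - α • 1) ^ n))
    refine iSup_le fun n x hx => Submodule.mem_iSup_of_mem n ?_
    rw [LinearMap.mem_ker] at hx ⊢
    rw [← Module.End.mul_apply, (hcomm n).eq, Module.End.mul_apply, hx, map_zero]
  · intro x hx
    rw [Submodule.mem_iInf] at hx ⊢
    intro n
    obtain ⟨y, rfl⟩ := hx n
    exact ⟨u y, LinearMap.congr_fun (hcomm n).eq y⟩
end
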